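/- Let F be a positive integer and let X be a Sat(F)-set. Then Sat(F)[X], the intersection of all elements of Sat(F) containing X, is itself an element of Sat(F); it contains X, and it is contained in every S ∈ Sat(F) with X ⊆ S. In particular, Sat(F)[X] is the smallest element of Sat(F) containing X. -/

import Mathlib

/-- A numerical semigroup: subset of ℕ containing 0, closed under addition,
with finite complement. -/
def IsNumericalSemigroup (S : Set ℕ) : Prop :=
  0 ∈ S ∧ (∀ a ∈ S, ∀ b ∈ S, a + b ∈ S) ∧ Sᶜ.Finite

/-- `dOf S s = gcd {x ∈ S : x ≤ s}`. -/
noncomputable def dOf (S : Set ℕ) (s : ℕ) : ℕ :=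
  letI := Classical.decPred (· ∈ S)
  ((Finset.range (s + 1)).filter (· ∈ S)).gcd id

/-- A saturated numerical semigroup. -/
def IsSaturatedNS (S : Set ℕ) : Prop :=
  IsNumericalSemigroup S ∧ ∀ s ∈ S, s ≠ 0 → s + dOf S s ∈ S

/-- `Sat F`: saturated numerical semigroups with Frobenius number `F`. -/
def SatF (F : ℕ) : Set (Set ℕ) :=
  {S | IsSaturatedNS S ∧ F ∉ S ∧ ∀ x, x ∉ S → x ≤ F}

/-- Multiplicity: least nonzero element. -/
noncomputable def multOf (S : Set ℕ) : ℕ := sInf {x | x ∈ S ∧ x ≠ 0}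

/-- Pseudo-Frobenius numbers. -/
def PFset (S : Set ℕ) : Set ℕ := {z | z ∉ S ∧ ∀ s ∈ S, s ≠ 0 → z + s ∈ S}

/-- Special gaps. -/
def SGset (S : Set ℕ) : Set ℕ := {x | x ∈ PFset S ∧ 2 * x ∈ S}

/-- `TSet a b = ⟨a⟩ ∪ {x : x ≥ b}`. -/
def TSet (a b : ℕ) : Set ℕ := {x | a ∣ x} ∪ {x | b ≤ x}

/-- A `Sat(F)`-set. -/
def SatFSet (F : ℕ) (X : Set ℕ) : Prop :=
  X ∩ ({0} ∪ {x | F + 1 ≤ x}) = ∅ ∧ ∃ S ∈ SatF F, X ⊆ S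

/-- `Sat(F)[X]`: intersection of all elements of `Sat F` containing `X`. -/
def SatClosure (F : ℕ) (X : Set ℕ) : Set ℕ := ⋂₀ {S | S ∈ SatF F ∧ X ⊆ S}

/-- `X` is a minimal `Sat(F)`-system of generators of `S`. -/
def IsMinSatGen (F : ℕ) (X S : Set ℕ) : Prop :=
  SatFSet F X ∧ SatClosure F X = S ∧ ∀ Y : Set ℕ, Y ⊂ X → SatClosure F Y ≠ S

/-- The `Sat(F)`-rank of `S`: minimal cardinality of a `Sat(F)`-set `X`
with `Sat(F)[X] = S`. -/
noncomputable def SatRank (F : ℕ) (S : Set ℕ) : ℕ :=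
  sInf {k | ∃ X : Set ℕ, SatFSet F X ∧ SatClosure F X = S ∧ X.ncard = k}

theorem dvd_dOf_iff {S : Set ℕ} {s n : ℕ} :
    n ∣ dOf S s ↔ ∀ x ∈ S, x ≤ s → n ∣ x := by
  classical
  simp only [dOf, Finset.dvd_gcd_iff, Finset.mem_filter, Finset.mem_range, id]
  exact ⟨fun h x hx hs => h x ⟨by omega, hx⟩, fun h x hx => h x hx.2 (by omega)⟩

theorem dOf_dvd {S : Set ℕ} {s x : ℕ} (hx : x ∈ S) (hs : x ≤ s) : dOf S s ∣ x :=
  dvd_dOf_iff.1 dvd_rfl x hx hs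

/-- `dOf` reverses divisibility with respect to both the set and the bound. -/
theorem dOf_dvd_dOf {S T : Set ℕ} (h : T ⊆ S) {s t : ℕ} (hts : t ≤ s) :
    dOf S s ∣ dOf T t :=
  dvd_dOf_iff.2 fun _ hx hxt => dOf_dvd (h hx) (hxt.trans hts)

theorem IsSaturatedNS.add_mem_of_dOf_dvd {S : Set ℕ} (hS : IsSaturatedNS S) {s n : ℕ}
    (hs : s ∈ S) (h0 : s ≠ 0) (hn : dOf S s ∣ n) : s + n ∈ S := by
  induction n using Nat.strong_induction_on generalizing s with
  | _ n ih =>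
    rcases Nat.eq_zero_or_pos n with rfl | hpos
    · exact hs
    have hd : 0 < dOf S s := Nat.pos_of_dvd_of_pos hn hpos
    have hle : dOf S s ≤ n := Nat.le_of_dvd hpos hn
    have key := ih (n - dOf S s) (by omega) (hS.2 s hs h0) (by omega)
      ((dOf_dvd_dOf subset_rfl (Nat.le_add_right _ _)).trans (Nat.dvd_sub hn dvd_rfl))
    rwa [show s + dOf S s + (n - dOf S s) = s + n by omega] at key

theorem sInter_mem_SatF {F : ℕ} {C : Set (Set ℕ)} (hC : C ⊆ SatF F) (hne : C.Nonempty) :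
    ⋂₀ C ∈ SatF F := by
  have hle : ∀ x, x ∉ ⋂₀ C → x ≤ F := by
    intro x hx
    simp only [Set.mem_sInter, not_forall] at hx
    obtain ⟨S, hS, hxS⟩ := hx
    exact (hC hS).2.2 x hxS
  refine ⟨⟨⟨fun S hS => (hC hS).1.1.1, fun a ha b hb S hS => ?_,
    (Set.finite_Iic F).subset hle⟩, fun s hs h0 S hS => ?_⟩, ?_, hle⟩
  · exact (hC hS).1.1.2.1 a (ha S hS) b (hb S hS)
  · exact (hC hS).1.add_mem_of_dOf_dvd (hs S hS) h0
      (dOf_dvd_dOf (Set.sInter_subset_of_mem hS) le_rfl)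
  · obtain ⟨S, hS⟩ := hne
    exact fun h => (hC hS).2.1 (h S hS)

/-- `Sat(F)[X]` is the smallest element of `Sat(F)`
containing `X`. -/
theorem SatClosure_smallest (F : ℕ) (hF : 0 < F) (X : Set ℕ)
    (hX : SatFSet F X) :
    SatClosure F X ∈ SatF F ∧ X ⊆ SatClosure F X ∧
      ∀ S ∈ SatF F, X ⊆ S → SatClosure F X ⊆ S := by
  obtain ⟨-, S, hS, hXS⟩ := hX
  exact ⟨sInter_mem_SatF (fun _ h => h.1) ⟨S, hS, hXS⟩,
    Set.subset_sInter fun _ h => h.2,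
    fun _ h hXT => Set.sInter_subset_of_mem ⟨h, hXT⟩⟩
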